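/- arXiv:2305.07983 — 7 statements merged into one kernel-verified Lean document; each statement's English description precedes it below -/
import Mathlib

section
/- Let F be a field, let M and N be positive integers with M + 1 < N, and let f_1, …, f_M, x_1, …, x_N be M + N pairwise distinct elements of F. If coefficients e_1, …, e_N ∈ F satisfy Σ_{i=1}^{M} e_i·(x_g − f_i)^{-1} + Σ_{j=0}^{N−M−1} e_{M+1+j}·x_g^{j} = 0 for every g ∈ {1,…,N}, then e_1 = e_2 = … = e_N = 0. Consequently, the coefficients of the rational function F(z) = Σ_{i=1}^{M} e_i/(z − f_i) + Σ_{j=0}^{N−M−1} e_{M+1+j} z^{j} are uniquely determined by its values at the N points x_1, …, x_N. -/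
open Polynomial in
/-- A sum of simple fractions with distinct poles plus a polynomial, vanishing at sufficiently
many points away from the poles, has all its coefficients equal to zero. -/
theorem simple_fractions_add_polynomial_eq_zero {F ι κ : Type*} [Field F] [Fintype ι]
    [Fintype κ] {f : ι → F} {x : κ → F} (hf : Function.Injective f)
    (hx : Function.Injective x) (hfx : ∀ i g, f i ≠ x g) {K : ℕ}
    (hK : Fintype.card ι + K = Fintype.card κ) (a : ι → F) (q : F[X])
    (hq : q.degree < K) (h : ∀ g, ∑ i, a i * (x g - f i)⁻¹ + q.eval (x g) = 0) :
    (∀ i, a i = 0) ∧ q = 0 := by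
  classical
  set P : F[X] := ∑ i, C (a i) * Lagrange.nodal (Finset.univ.erase i) f +
    Lagrange.nodal Finset.univ f * q with hP
  have hdeg : P.degree < Fintype.card κ := by
    refine (degree_add_le _ _).trans_lt (max_lt ?_ ?_)
    · refine (degree_sum_le _ _).trans_lt ((Finset.sup_lt_iff (WithBot.bot_lt_coe _)).2 ?_)
      intro i _
      rw [← smul_eq_C_mul]
      refine (degree_smul_le _ _).trans_lt ?_
      rw [Lagrange.degree_nodal]
      have := Finset.card_erase_lt_of_mem (Finset.mem_univ i)
      rw [Finset.card_univ] at this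
      exact_mod_cast (by omega : (Finset.univ.erase i).card < Fintype.card κ)
    · by_cases h0 : q = 0
      · simp [h0]
      · rw [degree_mul, Lagrange.degree_nodal, degree_eq_natDegree h0, Finset.card_univ]
        have := (natDegree_lt_iff_degree_lt h0).2 hq
        exact_mod_cast (by omega : Fintype.card ι + q.natDegree < Fintype.card κ)
  have hP0 : P = 0 := by
    refine eq_zero_of_degree_lt_of_eval_index_eq_zero Finset.univ (v := x) hx.injOn
      (by simpa using hdeg) fun g _ => ?_
    have key : P.eval (x g) = (Lagrange.nodal Finset.univ f).eval (x g) *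
        (∑ i, a i * (x g - f i)⁻¹ + q.eval (x g)) := by
      rw [hP, eval_add, eval_mul, mul_add, eval_finsetSum, Finset.mul_sum]
      congr 1
      refine Finset.sum_congr rfl fun i _ => ?_
      have hne : x g - f i ≠ 0 := sub_ne_zero.2 (hfx i g).symm
      rw [Lagrange.nodal_eq_mul_nodal_erase (Finset.mem_univ i)]
      simp only [eval_mul, eval_sub, eval_X, eval_C]
      field_simp
    rw [key, h g, mul_zero]
  have ha : ∀ i, a i = 0 := by
    intro i
    have hi : P.eval (f i) = a i * (Lagrange.nodal (Finset.univ.erase i) f).eval (f i) := by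
      rw [hP, eval_add, eval_mul, Lagrange.eval_nodal_at_node (Finset.mem_univ i), zero_mul,
        add_zero, eval_finsetSum, Finset.sum_eq_single i]
      · rw [eval_mul, eval_C]
      · intro k _ hk
        rw [eval_mul, Lagrange.eval_nodal_at_node (by simpa using hk.symm), mul_zero]
      · simp
    rw [hP0, eval_zero] at hi
    refine (mul_eq_zero.1 hi.symm).resolve_right (Lagrange.eval_nodal_not_at_node ?_)
    intro k hk hik
    exact (Finset.ne_of_mem_erase hk) (hf hik).symm
  refine ⟨ha, ?_⟩
  simp only [ha, C_0, zero_mul, Finset.sum_const_zero, zero_add] at hP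
  exact (mul_eq_zero.1 (hP.symm.trans hP0)).resolve_left Lagrange.nodal_ne_zero

/-- Cauchy–Vandermonde interpolation lemma (Lemma 1): a function consisting of `M` simple
rational terms with distinct poles `f 1, …, f M` plus a polynomial of degree at most
`N - M - 1` is determined by its evaluations at `N` points `x 1, …, x N` that are distinct
from each other and from the poles.  Equivalently, if the evaluations all vanish then all
coefficients vanish; consequently the coefficients are uniquely determined by the values. -/
theorem stmt_0 {F : Type*} [Field F] (M N : ℕ) (hM : 0 < M) (hN : 0 < N)
    (hMN : M + 1 < N) (f : Fin M → F) (x : Fin N → F)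
    (hf : Function.Injective f) (hx : Function.Injective x)
    (hfx : ∀ i g, f i ≠ x g) :
    (∀ e : Fin N → F,
      (∀ g : Fin N,
        (∑ i : Fin M, e ⟨i, i.isLt.trans (by omega)⟩ * (x g - f i)⁻¹) +
          (∑ j : Fin (N - M), e ⟨M + j, by have := j.isLt; omega⟩ * x g ^ (j : ℕ)) = 0) →
      ∀ i, e i = 0) ∧
    (∀ e e' : Fin N → F,
      (∀ g : Fin N,
        (∑ i : Fin M, e ⟨i, i.isLt.trans (by omega)⟩ * (x g - f i)⁻¹) +
          (∑ j : Fin (N - M), e ⟨M + j, by have := j.isLt; omega⟩ * x g ^ (j : ℕ)) =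
        (∑ i : Fin M, e' ⟨i, i.isLt.trans (by omega)⟩ * (x g - f i)⁻¹) +
          (∑ j : Fin (N - M), e' ⟨M + j, by have := j.isLt; omega⟩ * x g ^ (j : ℕ))) →
      e = e') := by
  have main : ∀ e : Fin N → F,
      (∀ g : Fin N,
        (∑ i : Fin M, e ⟨i, i.isLt.trans (by omega)⟩ * (x g - f i)⁻¹) +
          (∑ j : Fin (N - M), e ⟨M + j, by have := j.isLt; omega⟩ * x g ^ (j : ℕ)) = 0) →
      ∀ i, e i = 0 := by
    intro e he
    set c : Fin (N - M) → F := fun j => e ⟨M + j, by have := j.isLt; omega⟩ with hc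
    obtain ⟨ha, hq⟩ := simple_fractions_add_polynomial_eq_zero hf hx hfx (K := N - M)
      (by simp only [Fintype.card_fin]; omega)
      (fun i => e ⟨i, i.isLt.trans (by omega)⟩)
      (∑ j : Fin (N - M), Polynomial.C (c j) * Polynomial.X ^ (j : ℕ))
      (Polynomial.degree_sum_fin_lt c)
      (fun g => by simpa [Polynomial.eval_finsetSum, hc] using he g)
    intro i
    by_cases hi : (i : ℕ) < M
    · exact ha ⟨i, hi⟩
    · have hcoeff := congrArg (Polynomial.coeff · (i - M : ℕ)) hq
      have hlt : (i : ℕ) - M < N - M := by omega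
      simp only [Polynomial.finsetSum_coeff, Polynomial.coeff_C_mul_X_pow,
        Polynomial.coeff_zero] at hcoeff
      rw [Finset.sum_eq_single ⟨i - M, hlt⟩ (fun j _ hj => if_neg fun h => hj (Fin.ext h.symm))
        (by simp), if_pos rfl] at hcoeff
      rw [← hcoeff]
      exact congrArg e (Fin.ext (by simp only; omega))
  refine ⟨main, fun e e' h => ?_⟩
  have hsub := main (e - e') fun g => by
    simp only [Pi.sub_apply, sub_mul, Finset.sum_sub_distrib]
    linear_combination h g
  exact funext fun i => sub_eq_zero.1 (hsub i)
end

section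
/- Let F be a field, let M and N be positive integers with M + 1 < N, and let f_1, …, f_M, x_1, …, x_N be M + N pairwise distinct elements of F. Then the N × N matrix V defined by V_{g,i} = (x_g − f_i)^{-1} for 1 ≤ i ≤ M and V_{g,M+1+j} = x_g^{j} for 0 ≤ j ≤ N − M − 1 is invertible (its determinant is nonzero). -/
open Polynomial in
/-- A rational function with simple poles at the distinct points `f i` and polynomial part `Q` of
degree less than `K`, which vanishes at `#ι + K` distinct points off the poles, is zero. -/
theorem eq_zero_of_sum_mul_inv_sub_add_eval_eq_zero {F ι κ : Type*} [Field F] [Fintype ι]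
    [Fintype κ] {f : ι → F} {x : κ → F} (hf : Function.Injective f) (hx : Function.Injective x)
    (hfx : ∀ i g, f i ≠ x g) {K : ℕ} (hcard : Fintype.card κ = Fintype.card ι + K)
    (a : ι → F) {Q : F[X]} (hQ : Q.degree < K)
    (h : ∀ g, ∑ i, a i * (x g - f i)⁻¹ + Q.eval (x g) = 0) : a = 0 ∧ Q = 0 := by
  classical
  let A : F[X] := ∑ i, a i • Lagrange.nodal (Finset.univ.erase i) f
  let D : F[X] := Lagrange.nodal Finset.univ f
  have hD : D ≠ 0 := (Lagrange.nodal_monic (s := Finset.univ) (v := f)).ne_zero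
  have hDdeg : D.degree = (Fintype.card ι : WithBot ℕ) := Lagrange.degree_nodal
  have hcard' : ((Fintype.card κ : ℕ) : WithBot ℕ) = K + Fintype.card ι := by
    rw [hcard, add_comm]; push_cast; rfl
  have hA : A.degree < Fintype.card κ := by
    refine (degree_sum_le _ _).trans_lt
      ((Finset.sup_lt_iff (WithBot.bot_lt_coe _)).2 fun i _ => ?_)
    refine (degree_smul_le _ _).trans_lt ?_
    rw [Lagrange.degree_nodal, Nat.cast_lt, hcard]
    exact (Finset.card_erase_lt_of_mem (Finset.mem_univ i)).trans_le (Nat.le_add_right _ _)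
  have hQD : (Q * D).degree < Fintype.card κ := by
    rw [degree_mul, hDdeg, hcard']
    exact WithBot.add_lt_add_right (WithBot.natCast_ne_bot _) hQ
  have hP : A + Q * D = 0 := by
    refine eq_zero_of_degree_lt_of_eval_index_eq_zero Finset.univ (v := x) hx.injOn
      ((degree_add_le _ _).trans_lt (max_lt hA hQD)) fun g _ => ?_
    have hA' : A.eval (x g) = (∑ i, a i * (x g - f i)⁻¹) * D.eval (x g) := by
      simp only [A, D, eval_finsetSum, eval_smul, smul_eq_mul, Lagrange.eval_nodal,
        Finset.sum_mul]
      refine Finset.sum_congr rfl fun i hi => ?_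
      rw [← Finset.mul_prod_erase _ _ hi, mul_assoc,
        inv_mul_cancel_left₀ (sub_ne_zero.2 (hfx i g).symm)]
    rw [eval_add, eval_mul, hA', ← add_mul, h, zero_mul]
  have ha : a = 0 := by
    funext i
    have hi := congrArg (eval (f i)) hP
    have hDi : D.eval (f i) = 0 := Lagrange.eval_nodal_at_node (Finset.mem_univ i)
    rw [eval_add, eval_mul, hDi, mul_zero, add_zero, eval_zero, eval_finsetSum,
      Finset.sum_eq_single i, eval_smul, smul_eq_mul] at hi
    · refine (mul_eq_zero.1 hi).resolve_right (Lagrange.eval_nodal_not_at_node fun j hj => ?_)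
      exact hf.ne (Finset.ne_of_mem_erase hj).symm
    · intro j _ hj
      rw [eval_smul, Lagrange.eval_nodal_at_node (Finset.mem_erase.2 ⟨hj.symm, Finset.mem_univ i⟩),
        smul_zero]
    · simp
  refine ⟨ha, ?_⟩
  have hA0 : A = 0 := by simp [A, ha]
  rw [hA0, zero_add] at hP
  exact (mul_eq_zero.1 hP).resolve_right hD

/-- The Cauchy–Vandermonde matrix with poles `f 1, …, f M` and evaluation points
`x 1, …, x N` (all `M + N` elements pairwise distinct, `M + 1 < N`), whose first `M`
columns are the reciprocals `(x g - f i)⁻¹` and whose remaining `N - M` columns are the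
monomials `x g ^ j`, is invertible (its determinant is nonzero). -/
theorem stmt_1 {F : Type*} [Field F] (M N : ℕ) (hM : 0 < M) (hN : 0 < N)
    (hMN : M + 1 < N) (f : Fin M → F) (x : Fin N → F)
    (hf : Function.Injective f) (hx : Function.Injective x)
    (hfx : ∀ i g, f i ≠ x g) :
    (Matrix.of fun g i : Fin N =>
      if h : (i : ℕ) < M then (x g - f ⟨i, h⟩)⁻¹ else x g ^ ((i : ℕ) - M)).det ≠ 0 := by
  obtain ⟨K, rfl⟩ := Nat.exists_eq_add_of_le (show M ≤ N by lia)
  intro hdet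
  obtain ⟨v, hv, hmul⟩ := Matrix.exists_mulVec_eq_zero_iff.2 hdet
  obtain ⟨ha, hQ⟩ := eq_zero_of_sum_mul_inv_sub_add_eval_eq_zero hf hx hfx (K := K) (by simp)
    (fun i => v (Fin.castAdd K i))
    (Polynomial.degree_sum_fin_lt fun j => v (Fin.natAdd M j)) fun g => by
      have hg := congrFun hmul g
      simp only [Matrix.mulVec, dotProduct, Fin.sum_univ_add, Matrix.of_apply, Fin.val_castAdd,
        Fin.val_natAdd, Fin.is_lt, dif_pos, Fin.eta, add_tsub_cancel_left,
        Nat.not_lt.2 (Nat.le_add_right M _), dif_neg, not_false_eq_true, Pi.zero_apply] at hg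
      simpa only [Polynomial.eval_finsetSum, Polynomial.eval_mul, Polynomial.eval_C,
        Polynomial.eval_pow, Polynomial.eval_X, mul_comm] using hg
  refine hv (funext fun i => Fin.addCases (fun i => congrFun ha i) (fun j => ?_) i)
  have hj := congrArg (fun p => Polynomial.coeff p j) hQ
  simpa [Polynomial.finsetSum_coeff, Polynomial.coeff_C_mul, Polynomial.coeff_X_pow,
    Fin.val_inj] using hj
end

section
/- Let F be a field, let Q be a finite set of size δ ≥ 1, let f : Q → F be injective, and let T ≥ 1. Let A, B ⊆ Q with |A ∩ B| ≤ 1, let a^n, b^n ∈ F[X] be polynomials of degree at most T − 1, and define ω(X) = Π_{q∈Q} (X − f(q)). For x ∈ F with x ∉ f(Q), set a(x) = ω(x)·(Σ_{q∈A} (x − f(q))^{-1} + a^n(x)) and b(x) = Σ_{q∈B} (x − f(q))^{-1} + b^n(x). Then there exists a polynomial β ∈ F[X] with deg β ≤ δ + 2T − 2 such that: (1) if A ∩ B = ∅, then a(x)·b(x) = β(x) for all x ∈ F ∖ f(Q); and (2) if A ∩ B = {q_0}, then a(x)·b(x) = β(x) + γ·(x − f(q_0))^{-1} for all x ∈ F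 ∖ f(Q), where γ = Π_{q ∈ Q∖{q_0}} (f(q_0) − f(q)) is nonzero. -/
open Polynomial Lagrange in
/-- The product of two pole sums, the first one weighted by the nodal polynomial, is the value of a
polynomial plus simple poles at the common nodes. Injectivity of the nodes is not needed. -/
theorem exists_natDegree_le_nodal_mul_sum_inv_mul_sum_inv {F Q : Type*} [Field F] [Fintype Q]
    [DecidableEq Q] (m n : ℕ) (f : Q → F) (A B : Finset Q) (u v : F[X])
    (hu : u.natDegree ≤ m) (hv : v.natDegree ≤ n) :
    ∃ β : F[X], β.natDegree ≤ Fintype.card Q + m + n ∧ ∀ x ∉ Set.range f,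
      ((∏ q, (x - f q)) * ((∑ q ∈ A, (x - f q)⁻¹) + u.eval x)) *
          ((∑ q ∈ B, (x - f q)⁻¹) + v.eval x) =
        β.eval x + ∑ q ∈ A ∩ B, (∏ r ∈ Finset.univ.erase q, (f q - f r)) * (x - f q)⁻¹ := by
  set W : Q → F[X] := fun p => nodal (Finset.univ.erase p) f with hW
  have hWdeg (p : Q) : (W p).natDegree ≤ Fintype.card Q := by
    rw [hW, natDegree_nodal]
    exact Finset.card_le_univ _
  refine ⟨(∑ p ∈ A, ∑ q ∈ B, W p /ₘ (X - C (f q))) + (∑ p ∈ A, W p) * v + (∑ q ∈ B, W q) * u +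
    nodal Finset.univ f * u * v, ?_, fun x hx => ?_⟩
  · have hsum (S : Finset Q) : (∑ p ∈ S, W p).natDegree ≤ Fintype.card Q :=
      natDegree_sum_le_of_forall_le _ _ fun p _ => hWdeg p
    refine natDegree_add_le_of_degree_le (natDegree_add_le_of_degree_le
      (natDegree_add_le_of_degree_le ?_ ?_) ?_) ?_
    · refine natDegree_sum_le_of_forall_le _ _ fun p _ =>
        natDegree_sum_le_of_forall_le _ _ fun q _ => ?_
      rw [natDegree_divByMonic _ (monic_X_sub_C _)]
      have := hWdeg p
      omega
    · exact (natDegree_mul_le_of_le (hsum A) hv).trans (by omega)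
    · exact (natDegree_mul_le_of_le (hsum B) hu).trans (by omega)
    · exact natDegree_mul_le_of_le (natDegree_mul_le_of_le natDegree_nodal.le hu) hv
  · have hx' (q : Q) : x - f q ≠ 0 := fun h => hx ⟨q, (sub_eq_zero.mp h).symm⟩
    have hpole (p : Q) : (∏ q, (x - f q)) * (x - f p)⁻¹ = (W p).eval x := by
      rw [hW, eval_nodal, ← Finset.mul_prod_erase _ _ (Finset.mem_univ p)]
      field_simp [hx' p]
    have hdiv (p q : Q) : (W p).eval x * (x - f q)⁻¹ =
        (W p /ₘ (X - C (f q))).eval x + (W p).eval (f q) * (x - f q)⁻¹ := by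
      have h := congrArg (eval x) (modByMonic_add_div (W p) (X - C (f q)))
      simp only [modByMonic_X_sub_C_eq_C_eval, eval_add, eval_mul, eval_sub, eval_X, eval_C] at h
      rw [← h]
      field_simp [hx' q]
      ring
    have hres : ∑ p ∈ A, ∑ q ∈ B, (W p).eval (f q) * (x - f q)⁻¹ =
        ∑ q ∈ A ∩ B, (∏ r ∈ Finset.univ.erase q, (f q - f r)) * (x - f q)⁻¹ := by
      have hdiag (p q : Q) : (W p).eval (f q) * (x - f q)⁻¹ =
          if p = q then (∏ r ∈ Finset.univ.erase q, (f q - f r)) * (x - f q)⁻¹ else 0 := by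
        split_ifs with h
        · rw [h, hW, eval_nodal]
        · rw [hW, eval_nodal_at_node (Finset.mem_erase.mpr ⟨Ne.symm h, Finset.mem_univ q⟩),
            zero_mul]
      simp_rw [hdiag, Finset.sum_ite_eq, ← Finset.sum_filter, Finset.filter_mem_eq_inter]
    have hsum (S : Finset Q) :
        (∏ q, (x - f q)) * ∑ q ∈ S, (x - f q)⁻¹ = ∑ q ∈ S, (W q).eval x := by
      simp_rw [Finset.mul_sum, hpole]
    have hAB : (∑ p ∈ A, (W p).eval x) * ∑ q ∈ B, (x - f q)⁻¹ =
        (∑ p ∈ A, ∑ q ∈ B, (W p /ₘ (X - C (f q))).eval x) +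
          ∑ p ∈ A, ∑ q ∈ B, (W p).eval (f q) * (x - f q)⁻¹ := by
      simp_rw [Finset.sum_mul_sum, hdiv, Finset.sum_add_distrib]
    simp only [eval_add, eval_mul, eval_finsetSum, eval_nodal]
    rw [← hres]
    linear_combination hAB + (∑ q ∈ B, (x - f q)⁻¹ + v.eval x) * hsum A + u.eval x * hsum B

/-- Product decomposition of one pair of CSA encoding functions (Eqs. (11)–(15)):
with `ω(x) = ∏_{q ∈ Q} (x - f q)`, `a(x) = ω(x)·(∑_{q ∈ A} (x - f q)⁻¹ + aⁿ(x))` and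
`b(x) = ∑_{q ∈ B} (x - f q)⁻¹ + bⁿ(x)` where the noise polynomials have degree `≤ T - 1`
and `|A ∩ B| ≤ 1`, the product `a(x)·b(x)` equals a polynomial `β` of degree at most
`δ + 2T - 2` plus, exactly when `A ∩ B = {q₀}`, a single rational term
`γ · (x - f q₀)⁻¹` with nonzero residue `γ = ∏_{q ≠ q₀} (f q₀ - f q)`. -/
theorem stmt_3 {F : Type*} [Field F] {Q : Type*} [Fintype Q] [DecidableEq Q]
    (δ T : ℕ) (hδ : 1 ≤ δ) (hT : 1 ≤ T) (hcard : Fintype.card Q = δ)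
    (f : Q → F) (hf : Function.Injective f)
    (A B : Finset Q) (hAB : (A ∩ B).card ≤ 1)
    (an bn : Polynomial F) (han : an.natDegree ≤ T - 1) (hbn : bn.natDegree ≤ T - 1) :
    ∃ β : Polynomial F, β.natDegree ≤ δ + 2 * T - 2 ∧
      ((A ∩ B = ∅ → ∀ x : F, x ∉ Set.range f →
        ((∏ q : Q, (x - f q)) * ((∑ q ∈ A, (x - f q)⁻¹) + an.eval x)) *
            ((∑ q ∈ B, (x - f q)⁻¹) + bn.eval x) = β.eval x) ∧
       (∀ q0 : Q, A ∩ B = {q0} →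
          (∏ q ∈ Finset.univ.erase q0, (f q0 - f q)) ≠ 0 ∧
          ∀ x : F, x ∉ Set.range f →
            ((∏ q : Q, (x - f q)) * ((∑ q ∈ A, (x - f q)⁻¹) + an.eval x)) *
                ((∑ q ∈ B, (x - f q)⁻¹) + bn.eval x) =
              β.eval x +
                (∏ q ∈ Finset.univ.erase q0, (f q0 - f q)) * (x - f q0)⁻¹)) := by
  obtain ⟨β, hβ, h⟩ :=
    exists_natDegree_le_nodal_mul_sum_inv_mul_sum_inv (T - 1) (T - 1) f A B an bn han hbn
  refine ⟨β, by omega, fun hempty x hx => ?_, fun q0 hq0 => ⟨?_, fun x hx => ?_⟩⟩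
  · rw [h x hx, hempty, Finset.sum_empty, add_zero]
  · exact Finset.prod_ne_zero_iff.mpr fun q hq =>
      sub_ne_zero.mpr (hf.ne (Finset.ne_of_mem_erase hq).symm)
  · rw [h x hx, hq0, Finset.sum_singleton]
end

section
/- Let F be a field and fix positive integers M_A, M_B, T, r, δ, p, α, s. Let S̃ ⊆ {1,…,M_A} × {1,…,M_B} have size rδ and be partitioned into disjoint groups Q_1, …, Q_r each of size δ, and let f : S̃ → F be injective. For k ∈ [r] define ω_k(X) = Π_{(q,u)∈Q_k} (X − f(q,u)); for i ∈ [M_A] let A^k_i = {(q,u) ∈ Q_k : q = i} and for j ∈ [M_B] let B^k_j = {(q,u) ∈ Q_k : u = j}. Given arbitrary noise coefficients z^a_{i,k,t}, z^b_{j,k,t} ∈ F (t ∈ [T]), define a^n_{i,k}(x) = Σ_{t=1}^{T} z^a_{i,k,t} x^{t−1}, b^n_{j,k}(x) = Σ_{t=1}^{T} z^b_{j,k,t} x^{t−1}, and for x ∈ F ∖ f(S̃) define a_{i,k}(x) = ω_k(x)·(Σ_{(q,u)∈A^k_i} (x − f(q,u))^{-1} + a^n_{i,k}(x)) and b_{j,k}(x)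 = Σ_{(q,u)∈B^k_j} (x − f(q,u))^{-1} + b^n_{j,k}(x). Let Ã_i be p × α matrices and B̃_j be α × s matrices over F, and set Â_k(x) = Σ_{i=1}^{M_A} a_{i,k}(x)·Ã_i and B̂_k(x) = Σ_{j=1}^{M_B} b_{j,k}(x)·B̃_j. Then there exist p × s matrices I_0, …, I_{δ+2T−2} over F such that for every x ∈ F ∖ f(S̃): Σ_{k=1}^{r} Â_k(x)·B̂_k(x) = Σ_{(i,j)∈S̃} γ_{i,j}·(x − f(i,j))^{-1}·Ã_i·B̃_j + Σ_{c=0}^{δ+2T−2} x^{c}·I_c, where for (i,j) ∈ Q_k the constant γ_{i,j} = Π_{(a,b)∈Q_k∖{(i,j)}} (f(i,j) − f(a,b)) is nonzero. -/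
open Polynomial in
/-- Off the nodes, dividing a nodal product by one factor is deleting that factor. -/
theorem eval_prod_erase_eq_mul_inv {F ι : Type*} [Field F] [DecidableEq ι] (Q : Finset ι)
    (f : ι → F) {e : ι} (he : e ∈ Q) {x : F} (hx : x ≠ f e) :
    (∏ e' ∈ Q.erase e, (X - C (f e'))).eval x = (∏ e' ∈ Q, (x - f e')) * (x - f e)⁻¹ := by
  have h : x - f e ≠ 0 := sub_ne_zero.mpr hx
  rw [← Finset.mul_prod_erase Q _ he, eval_prod]
  simp only [eval_sub, eval_X, eval_C]
  field_simp

open Polynomial in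
/-- Partial fraction expansion of `ω / ((X - f e₁) (X - f e₂))`, where `ω` is the nodal
polynomial of `Q`: there is a pole only when `e₁ = e₂`. -/
theorem exists_polynomial_prod_mul_inv_mul_inv {F ι : Type*} [Field F] [DecidableEq ι]
    (Q : Finset ι) (f : ι → F) {e₁ e₂ : ι} (h₁ : e₁ ∈ Q) (h₂ : e₂ ∈ Q) :
    ∃ P : F[X], P.natDegree ≤ Q.card ∧ ∀ x : F, (∀ e ∈ Q, x ≠ f e) →
      (∏ e ∈ Q, (x - f e)) * (x - f e₁)⁻¹ * (x - f e₂)⁻¹ =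
        (if e₁ = e₂ then (∏ e' ∈ Q.erase e₁, (f e₁ - f e')) * (x - f e₁)⁻¹ else 0) +
          P.eval x := by
  have hdeg (R : Finset ι) : (∏ e ∈ R, (X - C (f e))).natDegree = R.card := by simp
  by_cases h : e₁ = e₂
  · subst h
    set W : F[X] := ∏ e' ∈ Q.erase e₁, (X - C (f e')) with hW
    refine ⟨W /ₘ (X - C (f e₁)), ?_, fun x hx ↦ ?_⟩
    · rw [natDegree_divByMonic _ (monic_X_sub_C _), hW, hdeg]
      exact (Nat.sub_le _ _).trans Finset.card_erase_le
    · have hne : x - f e₁ ≠ 0 := sub_ne_zero.mpr (hx _ h₁)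
      have hdiv := congrArg (eval x) (modByMonic_add_div W (X - C (f e₁)))
      rw [modByMonic_X_sub_C_eq_C_eval] at hdiv
      have hres : W.eval (f e₁) = ∏ e' ∈ Q.erase e₁, (f e₁ - f e') := by
        simp [hW, eval_prod]
      simp only [eval_add, eval_mul, eval_C, eval_sub, eval_X, hres] at hdiv
      rw [← eval_prod_erase_eq_mul_inv Q f h₁ (hx _ h₁), ← hW, ← hdiv, if_pos rfl]
      field_simp
  · have h₂' : e₂ ∈ Q.erase e₁ := Finset.mem_erase.mpr ⟨Ne.symm h, h₂⟩
    refine ⟨∏ e ∈ (Q.erase e₁).erase e₂, (X - C (f e)), ?_, fun x hx ↦ ?_⟩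
    · rw [hdeg]
      exact Finset.card_erase_le.trans Finset.card_erase_le
    · rw [eval_prod_erase_eq_mul_inv _ f h₂' (hx _ h₂),
        ← eval_prod_erase_eq_mul_inv Q f h₁ (hx _ h₁), if_neg h, zero_add]
      simp [eval_prod]

open Polynomial in
/-- The product of two masked sums of simple fractions, multiplied by the nodal polynomial of `Q`,
has simple poles exactly at the common nodes, up to a polynomial. -/
theorem exists_polynomial_prod_mul_sum_inv_add {F ι : Type*} [Field F] [DecidableEq ι]
    (Q A B : Finset ι) (hA : A ⊆ Q) (hB : B ⊆ Q) (f : ι → F) {n : ℕ} (a b : F[X])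
    (ha : a.natDegree ≤ n) (hb : b.natDegree ≤ n) :
    ∃ P : F[X], P.natDegree ≤ Q.card + 2 * n ∧ ∀ x : F, (∀ e ∈ Q, x ≠ f e) →
      (∏ e ∈ Q, (x - f e)) * ((∑ e ∈ A, (x - f e)⁻¹) + a.eval x) *
          ((∑ e ∈ B, (x - f e)⁻¹) + b.eval x) =
        (∑ e ∈ A ∩ B, (∏ e' ∈ Q.erase e, (f e - f e')) * (x - f e)⁻¹) + P.eval x := by
  choose! R hRdeg hR using fun (e₁ : ι) (h₁ : e₁ ∈ Q) (e₂ : ι) (h₂ : e₂ ∈ Q) ↦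
    exists_polynomial_prod_mul_inv_mul_inv Q f h₁ h₂
  set W : ι → F[X] := fun e ↦ ∏ e' ∈ Q.erase e, (X - C (f e')) with hW
  have hWdeg (D : Finset ι) : (∑ e ∈ D, W e).natDegree ≤ Q.card :=
    natDegree_sum_le_of_forall_le _ _ fun e _ ↦ by
      simpa [hW] using Finset.card_erase_le (s := Q) (a := e)
  have hWeval (D : Finset ι) (hD : D ⊆ Q) (x : F) (hx : ∀ e ∈ Q, x ≠ f e) :
      (∑ e ∈ D, W e).eval x = (∏ e ∈ Q, (x - f e)) * ∑ e ∈ D, (x - f e)⁻¹ := by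
    rw [eval_finsetSum, Finset.mul_sum]
    exact Finset.sum_congr rfl fun e he ↦
      eval_prod_erase_eq_mul_inv Q f (hD he) (hx e (hD he))
  have hω : (∏ e ∈ Q, (X - C (f e))).natDegree ≤ Q.card := by simp
  refine ⟨(∑ e₁ ∈ A, ∑ e₂ ∈ B, R e₁ e₂) + (∑ e ∈ A, W e) * b + (∑ e ∈ B, W e) * a +
    (∏ e ∈ Q, (X - C (f e))) * a * b, ?_, fun x hx ↦ ?_⟩
  · refine natDegree_add_le_of_degree_le (natDegree_add_le_of_degree_le
      (natDegree_add_le_of_degree_le ?_ ?_) ?_) ?_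
    · exact (natDegree_sum_le_of_forall_le _ _ fun e₁ h₁ ↦
        natDegree_sum_le_of_forall_le _ _ fun e₂ h₂ ↦
          hRdeg e₁ (hA h₁) e₂ (hB h₂)).trans (Nat.le_add_right _ _)
    · exact (natDegree_mul_le_of_le (hWdeg A) hb).trans (by omega)
    · exact (natDegree_mul_le_of_le (hWdeg B) ha).trans (by omega)
    · exact (natDegree_mul_le_of_le (natDegree_mul_le_of_le hω ha) hb).trans (by omega)
  · have hpoles : (∏ e ∈ Q, (x - f e)) * (∑ e ∈ A, (x - f e)⁻¹) * (∑ e ∈ B, (x - f e)⁻¹) =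
        (∑ e ∈ A ∩ B, (∏ e' ∈ Q.erase e, (f e - f e')) * (x - f e)⁻¹) +
          (∑ e₁ ∈ A, ∑ e₂ ∈ B, R e₁ e₂).eval x := by
      rw [mul_assoc, Finset.sum_mul_sum, Finset.mul_sum, ← Finset.filter_mem_eq_inter,
        Finset.sum_filter, eval_finsetSum, ← Finset.sum_add_distrib]
      refine Finset.sum_congr rfl fun e₁ h₁ ↦ ?_
      rw [Finset.mul_sum, eval_finsetSum, ← Finset.sum_ite_eq B e₁
        (fun _ ↦ (∏ e' ∈ Q.erase e₁, (f e₁ - f e')) * (x - f e₁)⁻¹), ← Finset.sum_add_distrib]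
      exact Finset.sum_congr rfl fun e₂ h₂ ↦ by
        rw [← mul_assoc, hR e₁ (hA h₁) e₂ (hB h₂) x hx]
    have hωeval : (∏ e ∈ Q, (X - C (f e))).eval x = ∏ e ∈ Q, (x - f e) := by simp [eval_prod]
    simp only [eval_add, eval_mul, hWeval A hA x hx, hWeval B hB x hx, hωeval]
    linear_combination hpoles

open Polynomial in
/-- A finite family of coefficients is the coefficient family of a polynomial. -/
theorem exists_polynomial_eval_eq_sum_fin {F : Type*} [Field F] {n : ℕ} (z : Fin n → F) :
    ∃ P : F[X], P.natDegree ≤ n - 1 ∧ ∀ x : F, P.eval x = ∑ t : Fin n, z t * x ^ (t : ℕ) := by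
  refine ⟨∑ t : Fin n, C (z t) * X ^ (t : ℕ), ?_, fun x ↦ by simp [eval_finsetSum]⟩
  exact natDegree_sum_le_of_forall_le _ _ fun t _ ↦
    (natDegree_C_mul_X_pow_le _ _).trans (by omega)


/-- Correctness identity of the FPGMM scheme (Eqs. (17)–(19)): the sum over groups of the
products of the encoded matrices `Â_k(x) · B̂_k(x)` equals a sum of rational terms — one
per desired matrix product `Ã_i · B̃_j`, each with a distinct pole `f (i,j)` and nonzero
residue `γ_{i,j} = ∏_{(a,b) ∈ Q_k ∖ {(i,j)}} (f (i,j) - f (a,b))` — plus a matrix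
polynomial interference term of degree at most `δ + 2T - 2`. -/
theorem stmt_4 {F : Type*} [Field F]
    (MA MB T r δ p α s : ℕ)
    (hMA : 0 < MA) (hMB : 0 < MB) (hT : 0 < T) (hr : 0 < r) (hδ : 0 < δ)
    (hp : 0 < p) (hα : 0 < α) (hs : 0 < s)
    (S : Finset (Fin MA × Fin MB)) (hS : S.card = r * δ)
    (Q : Fin r → Finset (Fin MA × Fin MB))
    (hQcard : ∀ k, (Q k).card = δ)
    (hQdisj : ∀ k k', k ≠ k' → Disjoint (Q k) (Q k'))
    (hQunion : S = Finset.univ.biUnion Q)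
    (f : Fin MA × Fin MB → F) (hf : Set.InjOn f S)
    (za : Fin MA → Fin r → Fin T → F) (zb : Fin MB → Fin r → Fin T → F)
    (Atil : Fin MA → Matrix (Fin p) (Fin α) F)
    (Btil : Fin MB → Matrix (Fin α) (Fin s) F) :
    (∀ k : Fin r, ∀ e ∈ Q k, (∏ e' ∈ (Q k).erase e, (f e - f e')) ≠ 0) ∧
    ∃ I : Fin (δ + 2 * T - 1) → Matrix (Fin p) (Fin s) F,
      ∀ x : F, x ∉ f '' (S : Set (Fin MA × Fin MB)) →
        (∑ k : Fin r,
          (∑ i : Fin MA,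
            ((∏ e ∈ Q k, (x - f e)) *
              ((∑ e ∈ (Q k).filter (fun e => e.1 = i), (x - f e)⁻¹) +
                ∑ t : Fin T, za i k t * x ^ (t : ℕ))) • Atil i) *
          (∑ j : Fin MB,
            ((∑ e ∈ (Q k).filter (fun e => e.2 = j), (x - f e)⁻¹) +
              ∑ t : Fin T, zb j k t * x ^ (t : ℕ)) • Btil j)) =
        (∑ k : Fin r, ∑ e ∈ Q k,
          ((∏ e' ∈ (Q k).erase e, (f e - f e')) * (x - f e)⁻¹) • (Atil e.1 * Btil e.2)) +
        ∑ c : Fin (δ + 2 * T - 1), x ^ (c : ℕ) • I c := by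
  refine ⟨fun k e he ↦ Finset.prod_ne_zero_iff.mpr fun e' he' ↦ sub_ne_zero.mpr fun h ↦ ?_, ?_⟩
  · have hmem {d} (hd : d ∈ Q k) : d ∈ (S : Set (Fin MA × Fin MB)) := by
      rw [hQunion]; exact Finset.mem_biUnion.mpr ⟨k, Finset.mem_univ _, hd⟩
    exact Finset.ne_of_mem_erase he' (hf (hmem he) (hmem (Finset.mem_of_mem_erase he')) h).symm
  choose a hadeg ha using fun i k ↦ exists_polynomial_eval_eq_sum_fin (za i k)
  choose b hbdeg hb using fun j k ↦ exists_polynomial_eval_eq_sum_fin (zb j k)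
  choose P hPdeg hP using fun k i j ↦ exists_polynomial_prod_mul_sum_inv_add (Q k)
    ((Q k).filter (fun e ↦ e.1 = i)) ((Q k).filter (fun e ↦ e.2 = j))
    (Finset.filter_subset _ _) (Finset.filter_subset _ _) f (a i k) (b j k)
    (hadeg i k) (hbdeg j k)
  refine ⟨fun c ↦ ∑ k, ∑ i, ∑ j, (P k i j).coeff c • (Atil i * Btil j), fun x hx ↦ ?_⟩
  have hxQ (k : Fin r) : ∀ e ∈ Q k, x ≠ f e := fun e he h ↦ hx ⟨e, by
    rw [hQunion]; exact Finset.mem_biUnion.mpr ⟨k, Finset.mem_univ _, he⟩, h.symm⟩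
  have heval (k i j) : (P k i j).eval x =
      ∑ c : Fin (δ + 2 * T - 1), (P k i j).coeff c * x ^ (c : ℕ) := by
    have hdeg := hPdeg k i j
    rw [hQcard] at hdeg
    rw [Polynomial.eval_eq_sum_range' (n := δ + 2 * T - 1) (by omega), Finset.sum_range]
  have hinterference : ∑ c : Fin (δ + 2 * T - 1),
      x ^ (c : ℕ) • ∑ k, ∑ i, ∑ j, (P k i j).coeff c • (Atil i * Btil j) =
      ∑ k, ∑ i, ∑ j, (P k i j).eval x • (Atil i * Btil j) := by
    simp only [heval, Finset.sum_smul, Finset.smul_sum, smul_smul]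
    rw [Finset.sum_comm]
    refine Finset.sum_congr rfl fun k _ ↦ ?_
    rw [Finset.sum_comm]
    refine Finset.sum_congr rfl fun i _ ↦ ?_
    rw [Finset.sum_comm]
    simp only [mul_comm]
  have hpoles (k : Fin r) (g : Fin MA × Fin MB → F) :
      ∑ e ∈ Q k, g e • (Atil e.1 * Btil e.2) = ∑ i, ∑ j,
        (∑ e ∈ (Q k).filter (fun e ↦ e.1 = i) ∩ (Q k).filter (fun e ↦ e.2 = j), g e) •
          (Atil i * Btil j) := by
    rw [← Finset.sum_fiberwise (Q k) (fun e ↦ e.1)]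
    refine Finset.sum_congr rfl fun i _ ↦ ?_
    rw [← Finset.sum_fiberwise ((Q k).filter (fun e ↦ e.1 = i)) (fun e ↦ e.2)]
    refine Finset.sum_congr rfl fun j _ ↦ ?_
    rw [← Finset.filter_and, ← Finset.filter_filter, Finset.sum_smul]
    refine Finset.sum_congr rfl fun e he ↦ ?_
    simp only [Finset.mem_filter] at he
    rw [he.1.2, he.2]
  rw [hinterference, ← Finset.sum_add_distrib]
  refine Finset.sum_congr rfl fun k _ ↦ ?_
  rw [hpoles, Matrix.sum_mul, ← Finset.sum_add_distrib]
  refine Finset.sum_congr rfl fun i _ ↦ ?_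
  rw [Matrix.mul_sum, ← Finset.sum_add_distrib]
  refine Finset.sum_congr rfl fun j _ ↦ ?_
  rw [Matrix.smul_mul, Matrix.mul_smul, smul_smul, ← add_smul, ← hP k i j x (hxQ k), ha, hb]
end

section
/- Let F be a field and fix positive integers M_A, M_B, T, r, δ, p, α, s. Under the setup of the previous statement, additionally assume the residue constants γ_{i,j} ≠ 0 for all (i,j) ∈ S̃ (which holds by injectivity of f). If R = rδ + δ + 2T − 1 and x_1, …, x_R are distinct elements of F ∖ f(S̃), then the evaluations U_g = Σ_{k=1}^{r} Â_k(x_g)·B̂_k(x_g), g ∈ {1,…,R}, uniquely determine all matrix products Ã_i·B̃_j for (i,j) ∈ S̃; that is, if two families of matrices (Ã_i), (B̃_j) and (Ã'_i), (B̃'_j) (with the same encoding parameters f, partition, and noise coefficients) give the same R evaluations, then Ã_i·B̃_j = Ã'_i·B̃'_j for every (i,j) ∈ S̃. -/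
open Polynomial

lemma natDegree_prod_X_sub_C_apply {F E : Type*} [Field F] (P : Finset E) (f : E → F) :
    (∏ e ∈ P, (X - C (f e))).natDegree = P.card := by
  rw [natDegree_prod_of_monic _ _ fun e _ => monic_X_sub_C (f e)]
  simp

/-- The numerator, over the common denominator `∏ e ∈ P, (X - f e)`, of the rational function
`∑ e ∈ G, (X - f e)⁻¹ + ∑ t, z t * X ^ t`. -/
noncomputable def csaNumerator {F E : Type*} [Field F] [DecidableEq E] {T : ℕ}
    (P G : Finset E) (f : E → F) (z : Fin T → F) : F[X] :=
  ∑ e ∈ G, ∏ e' ∈ P.erase e, (X - C (f e')) +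
    (∏ e ∈ P, (X - C (f e))) * ∑ t : Fin T, C (z t) * X ^ (t : ℕ)

section csaNumerator

variable {F E : Type*} [Field F] [DecidableEq E] {T : ℕ} {P G : Finset E} {f : E → F}
  {z : Fin T → F}

lemma natDegree_csaNumerator_le (hT : 0 < T) :
    (csaNumerator P G f z).natDegree ≤ P.card + (T - 1) := by
  refine natDegree_add_le_of_degree_le (natDegree_sum_le_of_forall_le _ _ fun e he => ?_)
    (natDegree_mul_le_of_le (natDegree_prod_X_sub_C_apply P f).le
      (natDegree_sum_le_of_forall_le _ _ fun t _ => ?_))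
  · rw [natDegree_prod_X_sub_C_apply]
    exact (Finset.card_erase_le).trans (Nat.le_add_right _ _)
  · exact (natDegree_C_mul_X_pow_le _ _).trans (by omega)

lemma eval_csaNumerator (hG : G ⊆ P) {y : F} (hy : ∀ e ∈ P, y - f e ≠ 0) :
    (csaNumerator P G f z).eval y =
      (∏ e ∈ P, (y - f e)) * (∑ e ∈ G, (y - f e)⁻¹ + ∑ t : Fin T, z t * y ^ (t : ℕ)) := by
  simp only [csaNumerator, eval_add, eval_mul, eval_finsetSum, eval_prod, eval_sub, eval_X,
    eval_C, eval_pow, mul_add, Finset.mul_sum]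
  congr 1
  refine Finset.sum_congr rfl fun e he => ?_
  rw [← Finset.mul_prod_erase P _ (hG he), mul_comm, inv_mul_cancel_left₀ (hy e (hG he))]

lemma eval_csaNumerator_pole {e : E} (he : e ∈ P) :
    (csaNumerator P G f z).eval (f e) =
      if e ∈ G then ∏ e' ∈ P.erase e, (f e - f e') else 0 := by
  have hP : ∏ e' ∈ P, (f e - f e') = 0 := Finset.prod_eq_zero he (sub_self _)
  simp only [csaNumerator, eval_add, eval_mul, eval_finsetSum, eval_prod, eval_sub, eval_X,
    eval_C, hP, zero_mul, add_zero]
  rw [← Finset.sum_ite_eq G e fun e => ∏ e' ∈ P.erase e, (f e - f e')]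
  refine Finset.sum_congr rfl fun a _ => ?_
  split_ifs with h
  · rw [h]
  · exact Finset.prod_eq_zero (Finset.mem_erase.2 ⟨h, he⟩) (sub_self _)

end csaNumerator

/-- The numerator, over the common denominator `∏ e ∈ S, (X - f e)`, of an entry of the response
`∑ k, Â_k * B̂_k`, where `a i` and `b j` are the values of that row of `Ã_i` and that column
of `B̃_j`. -/
noncomputable def responseNumerator {F I J K L : Type*} [Field F] [DecidableEq I] [DecidableEq J]
    [Fintype I] [Fintype J] [Fintype K] [Fintype L] {T : ℕ}
    (S : Finset (I × J)) (Q : K → Finset (I × J)) (f : I × J → F)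
    (za : I → K → Fin T → F) (zb : J → K → Fin T → F) (a : I → L → F) (b : J → L → F) : F[X] :=
  ∑ k, (∏ e ∈ S \ Q k, (X - C (f e))) * ∑ l,
    (∑ i, csaNumerator (Q k) ((Q k).filter fun e => e.1 = i) f (za i k) * C (a i l)) *
    (∑ j, csaNumerator (Q k) ((Q k).filter fun e => e.2 = j) f (zb j k) * C (b j l))

section responseNumerator

variable {F I J K L : Type*} [Field F] [DecidableEq I] [DecidableEq J]
  [Fintype I] [Fintype J] [Fintype K] [Fintype L] {T : ℕ}
  {S : Finset (I × J)} {Q : K → Finset (I × J)} {f : I × J → F}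
  {za : I → K → Fin T → F} {zb : J → K → Fin T → F} {a : I → L → F} {b : J → L → F}

lemma natDegree_responseNumerator_le (hT : 0 < T) {δ : ℕ} (hQ : ∀ k, (Q k).card = δ)
    (hQS : ∀ k, Q k ⊆ S) :
    (responseNumerator S Q f za zb a b).natDegree ≤ S.card + δ + 2 * (T - 1) := by
  refine natDegree_sum_le_of_forall_le _ _ fun k _ => ?_
  have hle := Finset.card_le_card (hQS k)
  have hcard := Finset.card_sdiff_of_subset (hQS k)
  have hk := hQ k
  refine (natDegree_mul_le_of_le (n := (δ + (T - 1)) + (δ + (T - 1)))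
    (natDegree_prod_X_sub_C_apply (S \ Q k) f).le
    (natDegree_sum_le_of_forall_le _ _ fun l _ => natDegree_mul_le_of_le
      (natDegree_sum_le_of_forall_le _ _ fun i _ => ?_)
      (natDegree_sum_le_of_forall_le _ _ fun j _ => ?_))).trans (by omega)
  · exact (natDegree_mul_C_le _ _).trans
      (hk ▸ natDegree_csaNumerator_le hT)
  · exact (natDegree_mul_C_le _ _).trans
      (hk ▸ natDegree_csaNumerator_le hT)

lemma eval_responseNumerator (hQS : ∀ k, Q k ⊆ S) {y : F} (hy : ∀ e ∈ S, y - f e ≠ 0) :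
    (responseNumerator S Q f za zb a b).eval y = (∏ e ∈ S, (y - f e)) *
      ∑ k, ∑ l, (∑ i, ((∏ e ∈ Q k, (y - f e)) *
          ((∑ e ∈ (Q k).filter (fun e => e.1 = i), (y - f e)⁻¹) +
            ∑ t : Fin T, za i k t * y ^ (t : ℕ))) * a i l) *
        (∑ j, ((∑ e ∈ (Q k).filter (fun e => e.2 = j), (y - f e)⁻¹) +
            ∑ t : Fin T, zb j k t * y ^ (t : ℕ)) * b j l) := by
  have hyQ : ∀ k, ∀ e ∈ Q k, y - f e ≠ 0 := fun k e he => hy e (hQS k he)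
  simp only [responseNumerator, eval_finsetSum, eval_mul, eval_prod, eval_sub, eval_X, eval_C,
    Finset.mul_sum (s := Finset.univ (α := K))]
  refine Finset.sum_congr rfl fun k _ => ?_
  rw [← Finset.prod_sdiff (hQS k), mul_assoc]
  congr 1
  rw [Finset.mul_sum]
  refine Finset.sum_congr rfl fun l _ => ?_
  simp only [eval_csaNumerator (Finset.filter_subset _ _) (hyQ k), mul_assoc, ← Finset.mul_sum]
  ring

lemma eval_responseNumerator_pole (hQS : ∀ k, Q k ⊆ S)
    (hQdisj : ∀ k k', k ≠ k' → Disjoint (Q k) (Q k')) {k : K} {e : I × J} (he : e ∈ Q k) :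
    (responseNumerator S Q f za zb a b).eval (f e) =
      (∏ e' ∈ S \ Q k, (f e - f e')) * (∏ e' ∈ (Q k).erase e, (f e - f e')) ^ 2 *
        ∑ l, a e.1 l * b e.2 l := by
  simp only [responseNumerator, eval_finsetSum, eval_mul, eval_prod, eval_sub, eval_X, eval_C]
  rw [Finset.sum_eq_single k]
  · simp only [eval_csaNumerator_pole he, Finset.mem_filter, he, true_and, ite_mul, zero_mul,
      Finset.sum_ite_eq, Finset.mem_univ, if_true]
    simp only [Finset.mul_sum]
    exact Finset.sum_congr rfl fun l _ => by ring
  · intro k' _ hk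
    refine mul_eq_zero_of_left (Finset.prod_eq_zero (i := e) ?_ (sub_self _)) _
    exact Finset.mem_sdiff.2 ⟨hQS k he, Finset.disjoint_left.1 (hQdisj k k' hk.symm) he⟩
  · exact fun h => (h (Finset.mem_univ k)).elim

end responseNumerator

/-- Recovery threshold of Theorem 1: with the CSA encoding of the FPGMM scheme (partition
`Q_1, …, Q_r` of `S̃` into groups of size `δ`, injective parameters `f`, noise polynomials
of degree `≤ T - 1`, and nonzero residues `γ_{i,j}`), the `R = rδ + δ + 2T - 1` worker
outputs `U_g = ∑_k Â_k(x_g)·B̂_k(x_g)` at distinct evaluation points outside the poles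
uniquely determine all desired matrix products `Ã_i·B̃_j`, `(i,j) ∈ S̃`. -/
theorem stmt_6 {F : Type*} [Field F]
    (MA MB T r δ p α s : ℕ)
    (hMA : 0 < MA) (hMB : 0 < MB) (hT : 0 < T) (hr : 0 < r) (hδ : 0 < δ)
    (hp : 0 < p) (hα : 0 < α) (hs : 0 < s)
    (S : Finset (Fin MA × Fin MB)) (hS : S.card = r * δ)
    (Q : Fin r → Finset (Fin MA × Fin MB))
    (hQcard : ∀ k, (Q k).card = δ)
    (hQdisj : ∀ k k', k ≠ k' → Disjoint (Q k) (Q k'))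
    (hQunion : S = Finset.univ.biUnion Q)
    (f : Fin MA × Fin MB → F) (hf : Set.InjOn f S)
    (hγ : ∀ k : Fin r, ∀ e ∈ Q k, (∏ e' ∈ (Q k).erase e, (f e - f e')) ≠ 0)
    (za : Fin MA → Fin r → Fin T → F) (zb : Fin MB → Fin r → Fin T → F)
    (R : ℕ) (hR : R = r * δ + δ + 2 * T - 1)
    (x : Fin R → F) (hx : Function.Injective x)
    (hxf : ∀ g, x g ∉ f '' (S : Set (Fin MA × Fin MB)))
    (Atil Atil' : Fin MA → Matrix (Fin p) (Fin α) F)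
    (Btil Btil' : Fin MB → Matrix (Fin α) (Fin s) F)
    (hU : ∀ g : Fin R,
      (∑ k : Fin r,
        (∑ i : Fin MA,
          ((∏ e ∈ Q k, (x g - f e)) *
            ((∑ e ∈ (Q k).filter (fun e => e.1 = i), (x g - f e)⁻¹) +
              ∑ t : Fin T, za i k t * x g ^ (t : ℕ))) • Atil i) *
        (∑ j : Fin MB,
          ((∑ e ∈ (Q k).filter (fun e => e.2 = j), (x g - f e)⁻¹) +
            ∑ t : Fin T, zb j k t * x g ^ (t : ℕ)) • Btil j)) =
      (∑ k : Fin r,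
        (∑ i : Fin MA,
          ((∏ e ∈ Q k, (x g - f e)) *
            ((∑ e ∈ (Q k).filter (fun e => e.1 = i), (x g - f e)⁻¹) +
              ∑ t : Fin T, za i k t * x g ^ (t : ℕ))) • Atil' i) *
        (∑ j : Fin MB,
          ((∑ e ∈ (Q k).filter (fun e => e.2 = j), (x g - f e)⁻¹) +
            ∑ t : Fin T, zb j k t * x g ^ (t : ℕ)) • Btil' j))) :
    ∀ e ∈ S, Atil e.1 * Btil e.2 = Atil' e.1 * Btil' e.2 := by
  have hQS : ∀ k, Q k ⊆ S := fun k =>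
    hQunion ▸ Finset.subset_biUnion_of_mem Q (Finset.mem_univ k)
  have hpole : ∀ g, ∀ e ∈ S, x g - f e ≠ 0 := fun g e he h =>
    hxf g ⟨e, he, (sub_eq_zero.1 h).symm⟩
  intro e he
  obtain ⟨k, -, hk⟩ := Finset.mem_biUnion.1 (hQunion ▸ he)
  have hne : (∏ e' ∈ S \ Q k, (f e - f e')) * (∏ e' ∈ (Q k).erase e, (f e - f e')) ^ 2 ≠ 0 := by
    refine mul_ne_zero (Finset.prod_ne_zero_iff.2 fun e' he' h => ?_) (pow_ne_zero 2 (hγ k e hk))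
    obtain ⟨heS, heQ⟩ := Finset.mem_sdiff.1 he'
    exact heQ (hf he heS (sub_eq_zero.1 h) ▸ hk)
  ext u v
  have hpoly : responseNumerator S Q f za zb (fun i l => Atil i u l) (fun j l => Btil j l v) =
      responseNumerator S Q f za zb (fun i l => Atil' i u l) (fun j l => Btil' j l v) := by
    refine eq_of_natDegree_lt_card_of_eval_eq _ _ hx (fun g => ?_) ?_
    · rw [eval_responseNumerator hQS (hpole g), eval_responseNumerator hQS (hpole g)]
      have hUg := congrFun (congrFun (hU g) u) v
      simp only [Matrix.sum_apply, Matrix.mul_apply, Matrix.smul_apply, smul_eq_mul] at hUg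
      rw [hUg]
    · rw [Fintype.card_fin, hR, ← hS]
      exact max_lt ((natDegree_responseNumerator_le hT hQcard hQS).trans_lt (by omega))
        ((natDegree_responseNumerator_le hT hQcard hQS).trans_lt (by omega))
  have heval := congrArg (eval (f e)) hpoly
  rw [eval_responseNumerator_pole hQS hQdisj hk, eval_responseNumerator_pole hQS hQdisj hk] at heval
  simpa only [Matrix.mul_apply] using mul_left_cancel₀ hne heval
end

section
/- Let F be a field and fix positive integers M_A, M_B, T, r, δ. Let S̃ ⊆ [M_A]×[M_B] have size rδ, partitioned into disjoint groups Q_1, …, Q_r of size δ, let f : S̃ → F be injective, and let x_1, …, x_T be distinct elements of F ∖ f(S̃). Define ω_k, A^k_i, B^k_j, and, for each choice of noise coefficient vector z = (z^a_{i,k,t}, z^b_{j,k,t}) ∈ F^{(M_A + M_B)·r·T}, the encoding functions a_{i,k} and b_{j,k} as in the scheme. Then the map Φ : F^{(M_A+M_B)rT} → F^{(M_A+M_B)rT} sending z to the full tuple of query evaluations ((a_{i,k}(x_g))_{i∈[M_A], k∈[r], g∈[T]}, (b_{j,k}(x_g))_{j∈[M_B], k∈[r], g∈[T]}) is a bijection.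 -/
/-- Evaluation of polynomials of degree less than `n`, given by their coefficients, at `n` distinct
points of a field is bijective. -/
theorem vandermonde_mulVec_bijective {F : Type*} [Field F] {n : ℕ} {x : Fin n → F}
    (hx : Function.Injective x) :
    Function.Bijective (Matrix.vandermonde x).mulVec := by
  have hu : IsUnit (Matrix.vandermonde x) :=
    (Matrix.isUnit_iff_isUnit_det _).2 (Matrix.det_vandermonde_ne_zero_iff.2 hx).isUnit
  exact ⟨Matrix.mulVec_injective_iff_isUnit.2 hu, Matrix.mulVec_surjective_iff_isUnit.2 hu⟩

/-- A family of affine evaluation maps at `n` distinct points, with nonzero weights `w` and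
offsets `c`, is bijective on the families of coefficient vectors. -/
theorem affine_eval_bijective {F ι κ : Type*} [Field F] {n : ℕ} {x : Fin n → F}
    (hx : Function.Injective x) (w c : ι × κ × Fin n → F) (hw : ∀ p, w p ≠ 0) :
    Function.Bijective (fun (z : ι × κ × Fin n → F) (p : ι × κ × Fin n) =>
      w p * (c p + ∑ t : Fin n, z (p.1, p.2.1, t) * x p.2.2 ^ (t : ℕ))) := by
  have hv := vandermonde_mulVec_bijective hx
  have hsum (v : Fin n → F) (g : Fin n) :
      (Matrix.vandermonde x).mulVec v g = ∑ t : Fin n, v t * x g ^ (t : ℕ) := by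
    simp [Matrix.mulVec, dotProduct, Matrix.vandermonde_apply, mul_comm]
  constructor
  · intro z z' h
    ext ⟨i, k, t⟩
    refine congrFun (hv.1 (a₁ := fun t => z (i, k, t)) (a₂ := fun t => z' (i, k, t)) ?_) t
    ext g
    rw [hsum, hsum]
    exact add_left_cancel (mul_left_cancel₀ (hw (i, k, g)) (congrFun h (i, k, g)))
  · intro y
    choose u hu using fun (i : ι) (k : κ) =>
      hv.2 fun g => (w (i, k, g))⁻¹ * y (i, k, g) - c (i, k, g)
    refine ⟨fun p => u p.1 p.2.1 p.2.2, ?_⟩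
    ext ⟨i, k, g⟩
    have h := congrFun (hu i k) g
    rw [hsum] at h
    simp only [h, add_sub_cancel]
    exact mul_inv_cancel_left₀ (hw _) _

/-- Deterministic core of the T-privacy proof: the map `Φ` sending the full vector of
noise coefficients `z = (zᵃ, zᵇ)` to the full tuple of query evaluations
`((a_{i,k}(x_g))_{i,k,g}, (b_{j,k}(x_g))_{j,k,g})` at the `T` distinct evaluation points
(outside the poles `f(S̃)`) of `T` colluding workers is a bijection of
`F^{(M_A + M_B)·r·T}`. -/
theorem stmt_9 {F : Type*} [Field F]
    (MA MB T r δ : ℕ)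
    (hMA : 0 < MA) (hMB : 0 < MB) (hT : 0 < T) (hr : 0 < r) (hδ : 0 < δ)
    (S : Finset (Fin MA × Fin MB)) (hS : S.card = r * δ)
    (Q : Fin r → Finset (Fin MA × Fin MB))
    (hQcard : ∀ k, (Q k).card = δ)
    (hQdisj : ∀ k k', k ≠ k' → Disjoint (Q k) (Q k'))
    (hQunion : S = Finset.univ.biUnion Q)
    (f : Fin MA × Fin MB → F) (hf : Set.InjOn f S)
    (x : Fin T → F) (hx : Function.Injective x)
    (hxf : ∀ g, x g ∉ f '' (S : Set (Fin MA × Fin MB))) :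
    Function.Bijective
      (fun z : ((Fin MA × Fin r × Fin T) → F) × ((Fin MB × Fin r × Fin T) → F) =>
        ((fun ikg : Fin MA × Fin r × Fin T =>
            (∏ e ∈ Q ikg.2.1, (x ikg.2.2 - f e)) *
              ((∑ e ∈ (Q ikg.2.1).filter (fun e => e.1 = ikg.1),
                  (x ikg.2.2 - f e)⁻¹) +
                ∑ t : Fin T, z.1 (ikg.1, ikg.2.1, t) * x ikg.2.2 ^ (t : ℕ)),
          fun jkg : Fin MB × Fin r × Fin T =>
            (∑ e ∈ (Q jkg.2.1).filter (fun e => e.2 = jkg.1),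
                (x jkg.2.2 - f e)⁻¹) +
              ∑ t : Fin T, z.2 (jkg.1, jkg.2.1, t) * x jkg.2.2 ^ (t : ℕ)) :
          ((Fin MA × Fin r × Fin T) → F) × ((Fin MB × Fin r × Fin T) → F))) := by
  have hw (p : Fin MA × Fin r × Fin T) : ∏ e ∈ Q p.2.1, (x p.2.2 - f e) ≠ 0 := by
    refine Finset.prod_ne_zero_iff.2 fun e he h => hxf p.2.2 ⟨e, ?_, (sub_eq_zero.1 h).symm⟩
    rw [hQunion]
    exact Finset.mem_biUnion.2 ⟨p.2.1, Finset.mem_univ _, he⟩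
  have ha := affine_eval_bijective hx
    (fun p : Fin MA × Fin r × Fin T => ∏ e ∈ Q p.2.1, (x p.2.2 - f e))
    (fun p => ∑ e ∈ (Q p.2.1).filter (fun e => e.1 = p.1), (x p.2.2 - f e)⁻¹) hw
  have hb := affine_eval_bijective hx (fun _ : Fin MB × Fin r × Fin T => (1 : F))
    (fun p => ∑ e ∈ (Q p.2.1).filter (fun e => e.2 = p.1), (x p.2.2 - f e)⁻¹)
    (fun _ => one_ne_zero)
  simp only [one_mul] at hb
  exact ha.prodMap hb
end

section
/- Let F be a finite field and fix positive integers M_A, M_B, T, r, δ. Let S̃ ⊆ [M_A]×[M_B] have size rδ, partitioned into disjoint groups Q_1, …, Q_r of size δ, let f : S̃ → F be injective, and let x_1, …, x_T be distinct elements of F ∖ f(S̃). If the noise coefficient vector Z is uniformly distributed on F^{(M_A+M_B)rT}, then the full tuple of query evaluations ((a_{i,k}(x_g))_{i,k,g}, (b_{j,k}(x_g))_{j,k,g}) is uniformly distributed on F^{(M_A+M_B)rT}. In particular, this distribution is the same for every admissible choice of the request set S̃, its partition into r groups, and the injective parameter assignment f; hence the joint queries observed by any T colluding workers are statistically independent of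 the request set. -/
theorem PMF.map_uniformOfFintype_of_bijective {α : Type*} [Fintype α] [Nonempty α]
    {e : α → α} (he : Function.Bijective e) :
    PMF.map e (PMF.uniformOfFintype α) = PMF.uniformOfFintype α := by
  classical
  ext b
  obtain ⟨a, rfl⟩ := he.surjective b
  rw [PMF.map_apply, tsum_eq_single a]
  · simp
  · intro a' ha'
    rw [if_neg fun h => ha' (he.injective h.symm)]

theorem eq_of_forall_sum_mul_pow_eq {R : Type*} [CommRing R] [IsDomain R] {n : ℕ}
    {x v w : Fin n → R} (hx : Function.Injective x)
    (h : ∀ g, ∑ t : Fin n, v t * x g ^ (t : ℕ) = ∑ t : Fin n, w t * x g ^ (t : ℕ)) : v = w := by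
  rw [← sub_eq_zero]
  refine Matrix.eq_zero_of_forall_index_sum_mul_pow_eq_zero hx fun g => ?_
  simp only [Pi.sub_apply, sub_mul, Finset.sum_sub_distrib, h g, sub_self]

/-- Perfect T-privacy of the FPGMM scheme (appendix of the paper): over a finite field,
if the noise coefficient vector `Z` is uniform on `F^{(M_A+M_B)·r·T}`, then the full tuple
of query evaluations `((a_{i,k}(x_g))_{i,k,g}, (b_{j,k}(x_g))_{j,k,g})` observed by `T`
colluding workers is uniformly distributed on `F^{(M_A+M_B)·r·T}` — in particular the
distribution is the same for every admissible request set `S̃`, partition `Q`, and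
injective parameter assignment `f`, so the queries are statistically independent of the
request set. -/
theorem stmt_10 {F : Type*} [Field F] [Fintype F]
    (MA MB T r δ : ℕ)
    (hMA : 0 < MA) (hMB : 0 < MB) (hT : 0 < T) (hr : 0 < r) (hδ : 0 < δ)
    (S : Finset (Fin MA × Fin MB)) (hS : S.card = r * δ)
    (Q : Fin r → Finset (Fin MA × Fin MB))
    (hQcard : ∀ k, (Q k).card = δ)
    (hQdisj : ∀ k k', k ≠ k' → Disjoint (Q k) (Q k'))
    (hQunion : S = Finset.univ.biUnion Q)
    (f : Fin MA × Fin MB → F) (hf : Set.InjOn f S)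
    (x : Fin T → F) (hx : Function.Injective x)
    (hxf : ∀ g, x g ∉ f '' (S : Set (Fin MA × Fin MB))) :
    PMF.map
      (fun z : ((Fin MA × Fin r × Fin T) → F) × ((Fin MB × Fin r × Fin T) → F) =>
        ((fun ikg : Fin MA × Fin r × Fin T =>
            (∏ e ∈ Q ikg.2.1, (x ikg.2.2 - f e)) *
              ((∑ e ∈ (Q ikg.2.1).filter (fun e => e.1 = ikg.1),
                  (x ikg.2.2 - f e)⁻¹) +
                ∑ t : Fin T, z.1 (ikg.1, ikg.2.1, t) * x ikg.2.2 ^ (t : ℕ)),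
          fun jkg : Fin MB × Fin r × Fin T =>
            (∑ e ∈ (Q jkg.2.1).filter (fun e => e.2 = jkg.1),
                (x jkg.2.2 - f e)⁻¹) +
              ∑ t : Fin T, z.2 (jkg.1, jkg.2.1, t) * x jkg.2.2 ^ (t : ℕ)) :
          ((Fin MA × Fin r × Fin T) → F) × ((Fin MB × Fin r × Fin T) → F)))
      (PMF.uniformOfFintype
        (((Fin MA × Fin r × Fin T) → F) × ((Fin MB × Fin r × Fin T) → F))) =
    PMF.uniformOfFintype
      (((Fin MA × Fin r × Fin T) → F) × ((Fin MB × Fin r × Fin T) → F)) := by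
  refine PMF.map_uniformOfFintype_of_bijective (Finite.injective_iff_bijective.mp ?_)
  have hprod (k : Fin r) (g : Fin T) : ∏ e ∈ Q k, (x g - f e) ≠ 0 := by
    refine Finset.prod_ne_zero_iff.mpr fun e he h0 => hxf g ⟨e, ?_, (sub_eq_zero.mp h0).symm⟩
    rw [hQunion]
    exact Finset.mem_biUnion.mpr ⟨k, Finset.mem_univ k, he⟩
  rintro ⟨a, b⟩ ⟨a', b'⟩ h
  obtain ⟨ha, hb⟩ := Prod.ext_iff.mp h
  refine Prod.ext (funext fun ⟨i, k, t⟩ => ?_) (funext fun ⟨j, k, t⟩ => ?_)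
  · refine congrFun (eq_of_forall_sum_mul_pow_eq (v := fun t => a (i, k, t))
      (w := fun t => a' (i, k, t)) hx fun g => ?_) t
    exact add_left_cancel (mul_left_cancel₀ (hprod k g) (congrFun ha (i, k, g)))
  · refine congrFun (eq_of_forall_sum_mul_pow_eq (v := fun t => b (j, k, t))
      (w := fun t => b' (j, k, t)) hx fun g => ?_) t
    exact add_left_cancel (congrFun hb (j, k, g))
end
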